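/- Let c1, c2, c3, c4 be generic real numbers, N ≥ 0 an integer, and c0 = −2N−3−c1−c2−c3−c4. For all integers i, j, k, ℓ ≥ 0 with i+j ≤ N and k+ℓ ≤ N, the Griffiths polynomials of Racah type satisfy the orthogonality relation Σ over integers x, y ≥ 0 with x+y ≤ N of Λ(y; c3,c0; N) · Ω(x; c1,c2,c4; N−y) · G_{i,j}(x,y) · G_{k,ℓ}(x,y) = δ_{i,k} · δ_{j,ℓ} · Λ(j; c4,c0; N) · Ω(i; c1,c2,c3; N−j). -/

import Mathlib

open Finset

noncomputable section

/-- Pochhammer symbol `(a)_k = a (a+1) ⋯ (a+k-1)`. -/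
def poch (a : ℝ) (k : ℕ) : ℝ := ∏ i ∈ Finset.range k, (a + i)

/-- A real number is *generic* if it is not an integer. -/
def Generic (r : ℝ) : Prop := ∀ m : ℤ, r ≠ (m : ℝ)

/-- Genericity for three parameters: none of the parameters, nor any sum of two or three
of them, is an integer; this guarantees that no denominator vanishes. -/
def Generic3 (c1 c2 c3 : ℝ) : Prop :=
  Generic c1 ∧ Generic c2 ∧ Generic c3 ∧
  Generic (c1+c2) ∧ Generic (c1+c3) ∧ Generic (c2+c3) ∧
  Generic (c1+c2+c3)

/-- Genericity for four parameters: none of the parameters, nor any sum of two, three or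
four of them, is an integer; this guarantees that no denominator vanishes. -/
def Generic4 (c1 c2 c3 c4 : ℝ) : Prop :=
  Generic c1 ∧ Generic c2 ∧ Generic c3 ∧ Generic c4 ∧
  Generic (c1+c2) ∧ Generic (c1+c3) ∧ Generic (c1+c4) ∧
  Generic (c2+c3) ∧ Generic (c2+c4) ∧ Generic (c3+c4) ∧
  Generic (c1+c2+c3) ∧ Generic (c1+c2+c4) ∧ Generic (c1+c3+c4) ∧ Generic (c2+c3+c4) ∧
  Generic (c1+c2+c3+c4)

/-- Normalization `Ω(n; c1,c2,c3; M)`. -/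
def Om (n : ℤ) (c1 c2 c3 : ℝ) (M : ℤ) : ℝ :=
  (M.toNat.choose n.toNat : ℝ) * (2*(n:ℝ) + c2 + c3 + 1) *
    poch (c2+1) n.toNat * poch ((M:ℝ)+2+c1+c2+c3) n.toNat * poch (c1+1) (M-n).toNat /
    (poch (c3+1) n.toNat * poch (c2+c3+(n:ℝ)+1) (M.toNat+1))

/-- The renormalized Racah polynomial `p_n(x; c1,c2,c3; M)`, with the convention that it
vanishes unless `0 ≤ n ≤ M`. -/
def racah (n : ℤ) (x : ℝ) (c1 c2 c3 : ℝ) (M : ℤ) : ℝ :=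
  if 0 ≤ n ∧ n ≤ M then
    Om n c1 c2 c3 M *
      ∑ k ∈ Finset.range (n.toNat + 1),
        (poch (-(n:ℝ)) k * poch ((n:ℝ)+c2+c3+1) k * poch (-x) k * poch (x+c1+c2+1) k) /
        (poch (c2+1) k * poch ((M:ℝ)+2+c1+c2+c3) k * poch (-(M:ℝ)) k * (Nat.factorial k : ℝ))
  else 0

/-- Weight `Λ(x; c1,c2; M)`. -/
def Lam (x : ℤ) (c1 c2 : ℝ) (M : ℤ) : ℝ :=
  (-1:ℝ)^x.toNat * (M.toNat.choose x.toNat : ℝ) * (2*(x:ℝ)+c1+c2+1) * poch (c2+1) x.toNat /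
    (poch (c1+1) x.toNat * poch ((x:ℝ)+c1+c2+1) (M.toNat+1))

/-- `λ(x; c) = x(x+c+1)`. -/
def lam (x c : ℝ) : ℝ := x*(x+c+1)

/-- `μ_n(c) = n(n+c+1)`. -/
def mu (n c : ℝ) : ℝ := n*(n+c+1)

/-- Recurrence coefficient `A_n(c1,c2,c3; M)`. -/
def coefA (n c1 c2 c3 M : ℝ) : ℝ :=
  (n-M)*(n+c1+c2+c3+M+2)*(n+c2+1)*(n+c2+c3+1)/((2*n+c2+c3+1)*(2*n+c2+c3+2))

/-- Recurrence coefficient `C_n(c1,c2,c3; M)`. -/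
def coefC (n c1 c2 c3 M : ℝ) : ℝ :=
  n*(n-c1-M-1)*(n+c2+c3+M+1)*(n+c3)/((2*n+c2+c3)*(2*n+c2+c3+1))

/-- `Σ_n = A_n + C_n`. -/
def coefSig (n c1 c2 c3 M : ℝ) : ℝ := coefA n c1 c2 c3 M + coefC n c1 c2 c3 M

/-- Difference coefficient `B(x; c1,c2,c3; M)`. -/
def coefB (x c1 c2 c3 M : ℝ) : ℝ :=
  (x-M)*(x+c2+1)*(x+c1+c2+c3+M+2)*(x+c1+c2+1)/((2*x+c1+c2+1)*(2*x+c1+c2+2))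

/-- Difference coefficient `D(x; c1,c2,c3; M)`. -/
def coefD (x c1 c2 c3 M : ℝ) : ℝ :=
  x*(x+c1)*(x-c3-M-1)*(x+c1+c2+M+1)/((2*x+c1+c2)*(2*x+c1+c2+1))

/-- `S = B + D`. -/
def coefS (x c1 c2 c3 M : ℝ) : ℝ := coefB x c1 c2 c3 M + coefD x c1 c2 c3 M

/-- `F(x; c1,c2)`. -/
def Ffun (x c1 c2 : ℝ) : ℝ :=
  (x+c2+1)*(x+c1+c2+1)/((2*x+c1+c2+1)*(2*x+c1+c2+2))

/-- `λ⁺(x; c12; M) = (x+c12+M+2)(x−M−1)`. -/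
def lamP (x c12 M : ℝ) : ℝ := (x+c12+M+2)*(x-M-1)

/-- `A⁺_n(c2,c3; M)`. -/
def Ap (n c2 c3 M : ℝ) : ℝ := -(n-M-1)*(n-M)*Ffun n c3 c2

/-- `C⁺_n(c2,c3; M) = A⁺_{−n−c23−1}(c2,c3; M)`. -/
def Cp (n c2 c3 M : ℝ) : ℝ := Ap (-n-c2-c3-1) c2 c3 M

/-- `Σ⁺_n = A⁺_n + C⁺_n + (M+1)(M+1+c3)`. -/
def Sp (n c2 c3 M : ℝ) : ℝ := Ap n c2 c3 M + Cp n c2 c3 M + (M+1)*(M+1+c3)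

/-- `λ⁻(x; c123, c3; M) = (x+c123+M+1)(x−M−c3)`. -/
def lamM (x c123 c3 M : ℝ) : ℝ := (x+c123+M+1)*(x-M-c3)

/-- `A⁻_n(c1,c2,c3; M)`. -/
def Am (n c1 c2 c3 M : ℝ) : ℝ := -(n+c1+c2+c3+M+1)*(n+c1+c2+c3+M+2)*Ffun n c3 c2

/-- `C⁻_n(c1,c2,c3; M) = A⁻_{−n−c23−1}(c1,c2,c3; M)`. -/
def Cm (n c1 c2 c3 M : ℝ) : ℝ := Am (-n-c2-c3-1) c1 c2 c3 M

/-- `Σ⁻_n = A⁻_n + C⁻_n + (M+c12+1)(M+c123+1)`. -/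
def Sm (n c1 c2 c3 M : ℝ) : ℝ :=
  Am n c1 c2 c3 M + Cm n c1 c2 c3 M + (M+c1+c2+1)*(M+c1+c2+c3+1)

/-- `μ⁺_n(c123, c1; M) = (n+c123+M+2)(n−M−1−c1)`. -/
def muP (n c123 c1 M : ℝ) : ℝ := (n+c123+M+2)*(n-M-1-c1)

/-- `B⁺(x; c1,c2,c3; M)`. -/
def Bp (x c1 c2 c3 M : ℝ) : ℝ := -(x+c1+c2+c3+M+2)*(x+c1+c2+c3+M+3)*Ffun x c1 c2

/-- `D⁺(x; c1,c2,c3; M) = B⁺(−x−c12−1; c1,c2,c3; M)`. -/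
def Dp (x c1 c2 c3 M : ℝ) : ℝ := Bp (-x-c1-c2-1) c1 c2 c3 M

/-- `S⁺ = B⁺ + D⁺ + (c23+M+2)(c123+M+2)`. -/
def SpD (x c1 c2 c3 M : ℝ) : ℝ :=
  Bp x c1 c2 c3 M + Dp x c1 c2 c3 M + (c2+c3+M+2)*(c1+c2+c3+M+2)

/-- `μ⁻_n(c23; M) = (n−M)(n+c23+M+1)`. -/
def muM (n c23 M : ℝ) : ℝ := (n-M)*(n+c23+M+1)

/-- `B⁻(x; c1,c2; M)`. -/
def Bm (x c1 c2 M : ℝ) : ℝ := -(x-M)*(x-M+1)*Ffun x c1 c2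

/-- `D⁻(x; c1,c2; M) = B⁻(−x−c12−1; c1,c2; M)`. -/
def Dm (x c1 c2 M : ℝ) : ℝ := Bm (-x-c1-c2-1) c1 c2 M

/-- `S⁻ = B⁻ + D⁻ + M(c1+M)`. -/
def SmD (x c1 c2 M : ℝ) : ℝ := Bm x c1 c2 M + Dm x c1 c2 M + M*(c1+M)

/-- Nine-point recurrence coefficients `A^{e,e'}_{i,j}(c1,c2,c3,c4)` (with
`c0 = −2N−3−c1−c2−c3−c4`). -/
def nineA (e e' : ℤ) (i j : ℝ) (c1 c2 c3 c4 N : ℝ) : ℝ :=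
  let c0 : ℝ := -2*N-3-c1-c2-c3-c4
  if e = 1 ∧ e' = 1 then -(Ffun (-j-c0-c4-1) c4 c0) * Cm i c1 c2 c3 (N-j+1)
  else if e = 0 ∧ e' = 1 then (Ffun (-j-c0-c4-1) c4 c0) * Sm i c1 c2 c3 (N-j+1)
  else if e = -1 ∧ e' = 1 then -(Ffun (-j-c0-c4-1) c4 c0) * Am i c1 c2 c3 (N-j+1)
  else if e = 1 ∧ e' = -1 then -(Ffun j c4 c0) * Cp i c2 c3 (N-j-1)
  else if e = 0 ∧ e' = -1 then (Ffun j c4 c0) * Sp i c2 c3 (N-j-1)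
  else if e = -1 ∧ e' = -1 then -(Ffun j c4 c0) * Ap i c2 c3 (N-j-1)
  else if e = 1 ∧ e' = 0 then (Ffun j c4 c0 + Ffun (-j-c0-c4-1) c4 c0) * coefC i c1 c2 c3 (N-j)
  else if e = 0 ∧ e' = 0 then
    -(Ffun j c4 c0 + Ffun (-j-c0-c4-1) c4 c0) *
      (coefSig i c1 c2 c3 (N-j) + (N-j)^2 + (c1+c2+c3+2)*(N-j) + (1/2)*(c3+1)*(c1+c2+c3+1))
  else if e = -1 ∧ e' = 0 then (Ffun j c4 c0 + Ffun (-j-c0-c4-1) c4 c0) * coefA i c1 c2 c3 (N-j)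
  else 0

/-- `Γ^{0,0}_{i,j}(c1,c2,c3,c4)`. -/
def gam00 (i j : ℝ) (c1 c2 c3 c4 N : ℝ) : ℝ :=
  let c0 : ℝ := -2*N-3-c1-c2-c3-c4
  (-(coefSig i c1 c2 c3 (N-j)) + coefSig j c1 c0 c4 (N-i) - (1/4)*(c3^2-c4^2)
    + (i-N-(1/2)*(c4+1))*(i+(1/2)*(c2+c3-c0-c1))
    - (j-N-(1/2)*(c3+1))*(j+(1/2)*(c0+c4-c1-c2)))

/-- `Γ^{e,e'}_{i,j}` coefficients. -/
def gam (e e' : ℤ) (i j : ℝ) (c1 c2 c3 c4 N : ℝ) : ℝ :=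
  let c0 : ℝ := -2*N-3-c1-c2-c3-c4
  if e = 0 ∧ e' = 1 then coefC j c1 c0 c4 (N-i)
  else if e = 0 ∧ e' = -1 then coefA j c1 c0 c4 (N-i)
  else if e = 1 ∧ e' = 0 then coefC i c1 c2 c3 (N-j)
  else if e = -1 ∧ e' = 0 then coefA i c1 c2 c3 (N-j)
  else if e = 0 ∧ e' = 0 then gam00 i j c1 c2 c3 c4 N
  else 0

/-- Nine-point difference coefficients `D^{e,e'}(x,y; c1,c2,c3,c4)` (with
`c0 = −2N−3−c1−c2−c3−c4`). -/
def nineD (e e' : ℤ) (x y : ℝ) (c1 c2 c3 c4 N : ℝ) : ℝ :=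
  let c0 : ℝ := -2*N-3-c1-c2-c3-c4
  if e = 1 ∧ e' = 1 then -(Ffun x c1 c2) * Bm y c3 c0 (N-x)
  else if e = 1 ∧ e' = 0 then (Ffun x c1 c2) * SmD y c3 c0 (N-x)
  else if e = 1 ∧ e' = -1 then -(Ffun x c1 c2) * Dm y c3 c0 (N-x)
  else if e = -1 ∧ e' = 1 then -(Ffun (-x-c1-c2-1) c1 c2) * Bp y c3 c0 c4 (N-x)
  else if e = -1 ∧ e' = 0 then (Ffun (-x-c1-c2-1) c1 c2) * SpD y c3 c0 c4 (N-x)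
  else if e = -1 ∧ e' = -1 then -(Ffun (-x-c1-c2-1) c1 c2) * Dp y c3 c0 c4 (N-x)
  else if e = 0 ∧ e' = 1 then (Ffun x c1 c2 + Ffun (-x-c1-c2-1) c1 c2) * coefB y c3 c0 c4 (N-x)
  else if e = 0 ∧ e' = 0 then
    -(Ffun x c1 c2 + Ffun (-x-c1-c2-1) c1 c2) *
      (coefS y c3 c0 c4 (N-x) + (N-x)^2 + (c0+c3+c4+2)*(N-x) + (1/2)*(c3+1)*(c0+c3+c4+1))
  else if e = 0 ∧ e' = -1 then (Ffun x c1 c2 + Ffun (-x-c1-c2-1) c1 c2) * coefD y c3 c0 c4 (N-x)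
  else 0

/-- `Ψ^{a,b}(x,y)` coefficients: the first superscript refers to the shift in `y`,
the second to the shift in `x` (with `c0 = −2N−3−c1−c2−c3−c4`). -/
def psi (a b : ℤ) (x y : ℝ) (c1 c2 c3 c4 N : ℝ) : ℝ :=
  let c0 : ℝ := -2*N-3-c1-c2-c3-c4
  if a = 0 ∧ b = 1 then coefB x c4 c2 c1 (N-y)
  else if a = 0 ∧ b = -1 then coefD x c4 c2 c1 (N-y)
  else if a = 1 ∧ b = 0 then coefB y c3 c0 c1 (N-x)
  else if a = -1 ∧ b = 0 then coefD y c3 c0 c1 (N-x)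
  else if a = 0 ∧ b = 0 then gam00 x y c1 c2 c4 c3 N
  else 0

/-- Tratnik polynomial of Racah type `T_{i,j}(x,y; c1,c2,c3,c4; N)`, set to `0` outside
the triangular domains. -/
def trat (c1 c2 c3 c4 : ℝ) (Nn : ℕ) (i j x y : ℤ) : ℝ :=
  let c0 : ℝ := -2*(Nn:ℝ)-3-c1-c2-c3-c4
  if 0 ≤ i ∧ 0 ≤ j ∧ i + j ≤ (Nn:ℤ) ∧ 0 ≤ x ∧ 0 ≤ y ∧ x + y ≤ (Nn:ℤ) then
    racah i (x:ℝ) c1 c2 c3 ((Nn:ℤ)-j) * racah j (y:ℝ) c3 c0 c4 ((Nn:ℤ)-x)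
  else 0

/-- Griffiths polynomial of Racah type `G_{i,j}(x,y; c1,c2,c3,c4; N)`, set to `0` outside
the triangular domains. -/
def grif (c1 c2 c3 c4 : ℝ) (Nn : ℕ) (i j x y : ℤ) : ℝ :=
  let c0 : ℝ := -2*(Nn:ℝ)-3-c1-c2-c3-c4
  if 0 ≤ i ∧ 0 ≤ j ∧ i + j ≤ (Nn:ℤ) ∧ 0 ≤ x ∧ 0 ≤ y ∧ x + y ≤ (Nn:ℤ) then
    ∑ a ∈ Finset.range (((Nn:ℤ)-j).toNat + 1),
      (-1:ℝ)^a * racah i (a:ℝ) c1 c2 c3 ((Nn:ℤ)-j) * racah j (y:ℝ) c3 c0 c4 ((Nn:ℤ)-(a:ℤ)) *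
        racah (a:ℤ) (x:ℝ) c4 c2 c1 ((Nn:ℤ)-y)
  else 0

/-- Krawtchouk polynomial `K_n(x; p; M)`, set to `0` unless `0 ≤ n ≤ M`. -/
def kraw (n : ℤ) (x : ℝ) (p : ℝ) (M : ℤ) : ℝ :=
  if 0 ≤ n ∧ n ≤ M then
    (M.toNat.choose n.toNat : ℝ) * (p/(1-p))^n.toNat *
      ∑ k ∈ Finset.range (n.toNat + 1),
        poch (-(n:ℝ)) k * poch (-x) k / (poch (-(M:ℝ)) k * (Nat.factorial k : ℝ)) * (1/p)^k
  else 0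

lemma Generic.add_intCast_ne_zero {r : ℝ} (h : Generic r) (m : ℤ) : r + m ≠ 0 := by
  intro h0
  apply h (-m)
  push_cast
  linarith

lemma Generic.of_eq_neg_add {r s : ℝ} (h : Generic r) (m : ℤ) (hs : s = m - r) : Generic s := by
  intro k hk
  apply h (m - k)
  push_cast
  linarith

lemma poch_zero (a : ℝ) : poch a 0 = 1 := by simp [poch]

lemma poch_succ (a : ℝ) (k : ℕ) : poch a (k + 1) = poch a k * (a + k) := by
  simp [poch, Finset.prod_range_succ]

lemma poch_succ_left (a : ℝ) (k : ℕ) : poch a (k + 1) = a * poch (a + 1) k := by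
  unfold poch
  rw [Finset.prod_range_succ', mul_comm]
  congr 1
  · simp
  · apply Finset.prod_congr rfl
    intro i _
    push_cast
    ring

lemma poch_add (a : ℝ) (m k : ℕ) : poch a (m + k) = poch a m * poch (a + m) k := by
  induction k with
  | zero => simp [poch_zero]
  | succ k ih =>
    rw [← Nat.add_assoc, poch_succ, ih, poch_succ]
    push_cast
    ring

lemma poch_reflect (a : ℝ) (k : ℕ) : poch (-a) k = (-1) ^ k * poch (a - k + 1) k := by
  induction k generalizing a with
  | zero => simp [poch_zero]
  | succ k ih =>
    rw [poch_succ_left, poch_succ, show -a + 1 = -(a - 1) by ring, ih]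
    push_cast
    rw [show a - 1 - (k : ℝ) + 1 = a - (k + 1) + 1 by ring]
    ring

lemma poch_ne_zero {a r : ℝ} (h : Generic r) (m : ℤ) (ha : a = r + m) (k : ℕ) :
    poch a k ≠ 0 := by
  unfold poch
  rw [Finset.prod_ne_zero_iff]
  intro i _
  rw [ha, add_assoc]
  exact_mod_cast h.add_intCast_ne_zero (m + i)

lemma poch_neg_natCast_ne_zero {k M : ℕ} (h : k ≤ M) : poch (-(M : ℝ)) k ≠ 0 := by
  unfold poch
  rw [Finset.prod_ne_zero_iff]
  intro i hi
  have : (i : ℝ) < M := by exact_mod_cast (Finset.mem_range.mp hi).trans_le h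
  linarith

lemma poch_neg_natCast_eq_zero {k n : ℕ} (h : n < k) : poch (-(n : ℝ)) k = 0 := by
  unfold poch
  exact Finset.prod_eq_zero (Finset.mem_range.mpr h) (by simp)

/-- The basis `(-x)_k (x+c+1)_k` of polynomials in `x(x+c+1)`. -/
def quadPoch (c x : ℝ) (k : ℕ) : ℝ := poch (-x) k * poch (x + c + 1) k

lemma quadPoch_zero (c x : ℝ) : quadPoch c x 0 = 1 := by simp [quadPoch, poch_zero]

lemma quadPoch_succ (c x : ℝ) (k : ℕ) :
    quadPoch c x (k + 1) = quadPoch c x k * ((k - x) * (x + c + 1 + k)) := by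
  simp only [quadPoch, poch_succ]
  ring

lemma quadPoch_shift_up (c x : ℝ) (k : ℕ) :
    (x + c + 1) * quadPoch c (x + 1) (k + 1) =
      quadPoch c x k * ((-x - 1) * (x + c + 1 + k) * (x + c + 2 + k)) := by
  have h : (x + c + 1) * poch (x + c + 1 + 1) (k + 1) =
      poch (x + c + 1) k * (x + c + 1 + k) * (x + c + 2 + k) := by
    rw [← poch_succ_left, poch_succ, poch_succ]
    push_cast
    ring
  have h1 := poch_succ_left (-(x + 1)) k
  rw [show -(x + 1) + 1 = -x by ring] at h1
  unfold quadPoch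
  rw [h1, show x + 1 + c + 1 = x + c + 1 + 1 by ring]
  linear_combination (-(x + 1) * poch (-x) k) * h

lemma quadPoch_shift_down (c x : ℝ) (k : ℕ) :
    x * quadPoch c (x - 1) (k + 1) =
      -quadPoch c x k * ((k - x) * (k + 1 - x) * (x + c)) := by
  have h : -x * poch (-x + 1) (k + 1) = poch (-x) k * (k - x) * (k + 1 - x) := by
    rw [← poch_succ_left, poch_succ, poch_succ]
    push_cast
    ring
  have h1 := poch_succ_left (x + c) k
  unfold quadPoch
  rw [show x - 1 + c + 1 = x + c by ring, h1, show -(x - 1) = -x + 1 by ring]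
  linear_combination (-(x + c) * poch (x + c + 1) k) * h

/-- The second-order difference operator diagonalized by the Racah polynomials. -/
def racahDiff (c1 c2 c3 M : ℝ) (f : ℝ → ℝ) (x : ℝ) : ℝ :=
  coefB x c1 c2 c3 M * (f (x + 1) - f x) + coefD x c1 c2 c3 M * (f (x - 1) - f x)

lemma racahDiff_quadPoch_succ {c1 c2 x : ℝ} (c3 M : ℝ) (k : ℕ)
    (h0 : 2 * x + c1 + c2 ≠ 0) (h1 : 2 * x + c1 + c2 + 1 ≠ 0) (h2 : 2 * x + c1 + c2 + 2 ≠ 0) :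
    racahDiff c1 c2 c3 M (fun z => quadPoch (c1 + c2) z (k + 1)) x =
      (k + 1) * (k + c2 + c3 + 2) * quadPoch (c1 + c2) x (k + 1) -
        (k + 1) * (c2 + k + 1) * (M + 2 + c1 + c2 + c3 + k) * (k - M) *
          quadPoch (c1 + c2) x k := by
  have hu := quadPoch_shift_up (c1 + c2) x k
  have hd := quadPoch_shift_down (c1 + c2) x k
  have hs := quadPoch_succ (c1 + c2) x k
  have hB : coefB x c1 c2 c3 M * quadPoch (c1 + c2) (x + 1) (k + 1) =
      (x - M) * (x + c2 + 1) * (x + c1 + c2 + c3 + M + 2) /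
        ((2 * x + c1 + c2 + 1) * (2 * x + c1 + c2 + 2)) *
        (quadPoch (c1 + c2) x k * ((-x - 1) * (x + (c1 + c2) + 1 + k) * (x + (c1 + c2) + 2 + k))) := by
    rw [← hu, coefB]
    ring
  have hD : coefD x c1 c2 c3 M * quadPoch (c1 + c2) (x - 1) (k + 1) =
      (x + c1) * (x - c3 - M - 1) * (x + c1 + c2 + M + 1) /
        ((2 * x + c1 + c2) * (2 * x + c1 + c2 + 1)) *
        (-quadPoch (c1 + c2) x k * ((k - x) * (k + 1 - x) * (x + (c1 + c2)))) := by
    rw [← hd, coefD]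
    ring
  simp only [racahDiff, mul_sub]
  rw [hB, hD, hs, coefB, coefD]
  generalize quadPoch (c1 + c2) x k = q
  obtain ⟨d, hd⟩ : ∃ d, d = 2 * x + c1 + c2 := ⟨_, rfl⟩
  rw [← hd] at h0 h1 h2 ⊢
  field_simp
  subst hd
  ring

/-- The terminating `₄F₃` series underlying the Racah polynomials. -/
def racahSum (n x c1 c2 c3 : ℝ) (M K : ℕ) : ℝ :=
  ∑ k ∈ Finset.range K, quadPoch (c2 + c3) n k * quadPoch (c1 + c2) x k /
    (poch (c2 + 1) k * poch (M + 2 + c1 + c2 + c3) k * poch (-(M : ℝ)) k * (Nat.factorial k : ℝ))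

lemma racahSum_swap (n x c1 c2 c3 : ℝ) (M K : ℕ) :
    racahSum n x c1 c2 c3 M K = racahSum x n c3 c2 c1 M K := by
  apply Finset.sum_congr rfl
  intro k _
  rw [add_comm c2 c3, add_comm c1 c2,
    show (M : ℝ) + 2 + c1 + c2 + c3 = M + 2 + c3 + c2 + c1 by ring,
    mul_comm (quadPoch _ n k)]

lemma racahSum_zero_left (x c1 c2 c3 : ℝ) (M K : ℕ) : racahSum 0 x c1 c2 c3 M (K + 1) = 1 := by
  rw [racahSum, Finset.sum_range_succ']
  simp [quadPoch, poch_zero, poch_succ_left]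

lemma racahSum_zero_right (n c1 c2 c3 : ℝ) (M K : ℕ) : racahSum n 0 c1 c2 c3 M (K + 1) = 1 := by
  rw [racahSum_swap, racahSum_zero_left]

lemma racahSum_eq_of_le (n : ℕ) (x c1 c2 c3 : ℝ) {M K : ℕ} (h : n < K) :
    racahSum n x c1 c2 c3 M K = racahSum n x c1 c2 c3 M (n + 1) := by
  symm
  apply Finset.sum_subset (Finset.range_mono h)
  intro k _ hk
  rw [Finset.mem_range, not_lt] at hk
  simp [quadPoch, poch_neg_natCast_eq_zero (show n < k by omega)]

lemma racah_natCast {n M : ℕ} (h : n ≤ M) (x c1 c2 c3 : ℝ) :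
    racah n x c1 c2 c3 M = Om n c1 c2 c3 M * racahSum n x c1 c2 c3 M (M + 1) := by
  rw [racahSum_eq_of_le n x c1 c2 c3 (show n < M + 1 by omega), racah,
    if_pos ⟨by positivity, by exact_mod_cast h⟩]
  congr 1
  apply Finset.sum_congr (by simp)
  intro k _
  simp only [quadPoch, Int.cast_natCast, add_assoc, mul_assoc]

lemma racahDiff_racahSum {c1 c2 c3 x : ℝ} (hg : Generic3 c1 c2 c3) (n M : ℕ) (hn : n ≤ M)
    (h0 : 2 * x + c1 + c2 ≠ 0) (h1 : 2 * x + c1 + c2 + 1 ≠ 0) (h2 : 2 * x + c1 + c2 + 2 ≠ 0) :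
    racahDiff c1 c2 c3 M (fun z => racahSum n z c1 c2 c3 M (M + 1)) x =
      n * (n + c2 + c3 + 1) * racahSum n x c1 c2 c3 M (M + 1) := by
  obtain ⟨-, g2, -, -, -, -, g123⟩ := hg
  have partialSum : ∀ K ≤ M,
      racahDiff c1 c2 c3 M (fun z => racahSum n z c1 c2 c3 M (K + 1)) x -
        n * (n + c2 + c3 + 1) * racahSum n x c1 c2 c3 M (K + 1) =
      quadPoch (c2 + c3) n (K + 1) * quadPoch (c1 + c2) x K /
        (poch (c2 + 1) K * poch (M + 2 + c1 + c2 + c3) K * poch (-(M : ℝ)) K *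
          (Nat.factorial K : ℝ)) := by
    intro K
    induction K with
    | zero =>
      intro _
      simp only [racahDiff, racahSum, quadPoch, zero_add, Finset.sum_range_one, poch_zero, poch_succ,
        Nat.factorial_zero, Nat.cast_zero, Nat.cast_one]
      ring
    | succ K ih =>
      intro hK
      have ih := ih (by omega)
      have key := racahDiff_quadPoch_succ c3 M K h0 h1 h2
      have split : ∀ z, racahSum n z c1 c2 c3 M (K + 1 + 1) = racahSum n z c1 c2 c3 M (K + 1) +
          quadPoch (c2 + c3) n (K + 1) * quadPoch (c1 + c2) z (K + 1) /
            (poch (c2 + 1) (K + 1) * poch (M + 2 + c1 + c2 + c3) (K + 1) *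
              poch (-(M : ℝ)) (K + 1) * (Nat.factorial (K + 1) : ℝ)) :=
        fun z => Finset.sum_range_succ _ _
      have p1 : poch (c2 + 1) K ≠ 0 := poch_ne_zero g2 1 (by push_cast; ring) _
      have p1' : c2 + 1 + K ≠ 0 := by
        have := g2.add_intCast_ne_zero (1 + K); push_cast at this; rwa [← add_assoc] at this
      have p2 : poch (M + 2 + c1 + c2 + c3) K ≠ 0 :=
        poch_ne_zero g123 (M + 2) (by push_cast; ring) _
      have p2' : (M : ℝ) + 2 + c1 + c2 + c3 + K ≠ 0 := by
        have := g123.add_intCast_ne_zero (M + 2 + K)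
        push_cast at this
        convert this using 1
        ring
      have p3 : poch (-(M : ℝ)) K ≠ 0 := poch_neg_natCast_ne_zero (by omega)
      have p3' : -(M : ℝ) + K ≠ 0 := by
        have : (K : ℝ) < M := by exact_mod_cast hK
        linarith
      have p4 : (Nat.factorial K : ℝ) ≠ 0 := by positivity
      have p4' : (K : ℝ) + 1 ≠ 0 := by positivity
      simp only [racahDiff, split] at ih key ⊢
      rw [quadPoch_succ _ _ (K + 1)]
      simp only [poch_succ _ K, Nat.factorial_succ]
      push_cast
      set q := quadPoch (c2 + c3) n (K + 1)
      set d := poch (c2 + 1) K * poch (M + 2 + c1 + c2 + c3) K * poch (-(M : ℝ)) K *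
          (Nat.factorial K : ℝ) with hd
      have hdne : d ≠ 0 := by positivity
      have e : poch (c2 + 1) K * (c2 + 1 + K) *
          (poch (M + 2 + c1 + c2 + c3) K * (M + 2 + c1 + c2 + c3 + K)) *
          (poch (-(M : ℝ)) K * (-(M : ℝ) + K)) * ((K + 1) * (Nat.factorial K : ℝ)) =
          d * ((c2 + 1 + K) * (M + 2 + c1 + c2 + c3 + K) * (-(M : ℝ) + K) * (K + 1)) := by
        rw [hd]; ring
      rw [e]
      have e2 : q * quadPoch (c1 + c2) x K / d =
          q / (d * ((c2 + 1 + K) * (M + 2 + c1 + c2 + c3 + K) * (-(M : ℝ) + K) * (K + 1))) *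
          ((c2 + 1 + K) * (M + 2 + c1 + c2 + c3 + K) * (-(M : ℝ) + K) * (K + 1) *
            quadPoch (c1 + c2) x K) := by
        field_simp
      rw [e2] at ih
      linear_combination ih + q / (d * ((c2 + 1 + K) * (M + 2 + c1 + c2 + c3 + K) *
        (-(M : ℝ) + K) * (K + 1))) * key
  have h := partialSum M le_rfl
  rw [quadPoch, poch_neg_natCast_eq_zero (show n < M + 1 by omega)] at h
  simp only [zero_mul, zero_div] at h
  linarith

lemma Generic3.reverse {c1 c2 c3 : ℝ} (h : Generic3 c1 c2 c3) : Generic3 c3 c2 c1 := by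
  obtain ⟨h1, h2, h3, h12, h13, h23, h123⟩ := h
  exact ⟨h3, h2, h1, add_comm c2 c3 ▸ h23, add_comm c1 c3 ▸ h13, add_comm c1 c2 ▸ h12,
    (show c1 + c2 + c3 = c3 + c2 + c1 by ring) ▸ h123⟩

lemma Om_natCast {n M : ℕ} (h : n ≤ M) (c1 c2 c3 : ℝ) :
    Om n c1 c2 c3 M = (M.choose n : ℝ) * (2 * n + c2 + c3 + 1) *
      poch (c2 + 1) n * poch (M + 2 + c1 + c2 + c3) n * poch (c1 + 1) (M - n) /
      (poch (c3 + 1) n * poch (c2 + c3 + n + 1) (M + 1)) := by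
  rw [Om, ← Nat.cast_sub h]
  simp only [Int.toNat_natCast, Int.cast_natCast]

lemma Om_mul_coefB {c1 c2 c3 : ℝ} (hg : Generic3 c1 c2 c3) {x M : ℕ} (hx : x < M) :
    Om x c3 c2 c1 M * coefB x c1 c2 c3 M =
      Om (x + 1 : ℕ) c3 c2 c1 M * coefD (x + 1) c1 c2 c3 M := by
  obtain ⟨g1, -, -, g12, -, -, -⟩ := hg
  rw [Om_natCast hx.le, Om_natCast (show x + 1 ≤ M from hx)]
  obtain ⟨r, rfl⟩ : ∃ r, M = x + 1 + r := ⟨M - (x + 1), by omega⟩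
  rw [show x + 1 + r - x = r + 1 by omega, show x + 1 + r - (x + 1) = r by omega]
  have hch : ((x + 1 + r).choose (x + 1) : ℝ) * (x + 1) = ((x + 1 + r).choose x : ℝ) * (r + 1) := by
    have := Nat.choose_succ_right_eq (x + 1 + r) x
    rw [show x + 1 + r - x = r + 1 by omega] at this
    exact_mod_cast this
  have hp : poch (c2 + c1 + x + 1) (x + 1 + r + 1) * (c2 + c1 + x + 1 + (x + 1 + r + 1)) =
      (c2 + c1 + x + 1) * poch (c2 + c1 + (x + 1) + 1) (x + 1 + r + 1) := by
    have h1 := poch_succ (c2 + c1 + x + 1) (x + 1 + r + 1)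
    rw [poch_succ_left] at h1
    push_cast at h1
    rw [← h1]
    ring_nf
  have n1 : poch (c1 + 1) x ≠ 0 := poch_ne_zero g1 1 (by push_cast; ring) _
  have n1' : c1 + 1 + x ≠ 0 := by
    have := g1.add_intCast_ne_zero (1 + x); push_cast at this; rwa [← add_assoc] at this
  have n2 : poch (c2 + c1 + x + 1) (x + 1 + r + 1) ≠ 0 :=
    poch_ne_zero g12 (x + 1) (by push_cast; ring) _
  have n4 : 2 * x + c1 + c2 + 1 ≠ 0 := by
    have := g12.add_intCast_ne_zero (2 * x + 1); push_cast at this; convert this using 1; ring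
  have n5 : 2 * x + c1 + c2 + 2 ≠ 0 := by
    have := g12.add_intCast_ne_zero (2 * x + 2); push_cast at this; convert this using 1; ring
  have n6 : 2 * x + c1 + c2 + 3 ≠ 0 := by
    have := g12.add_intCast_ne_zero (2 * x + 3); push_cast at this; convert this using 1; ring
  have n7 : (x : ℝ) + 1 ≠ 0 := by positivity
  have n8 : c2 + c1 + x + 1 ≠ 0 := by
    have := g12.add_intCast_ne_zero (x + 1); push_cast at this; convert this using 1; ring
  rw [poch_succ _ r, poch_succ (c2 + 1), poch_succ _ x, poch_succ (c1 + 1)]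
  push_cast
  rw [← eq_div_iff n7] at hch
  rw [mul_comm (c2 + c1 + x + 1), ← div_eq_iff n8] at hp
  have n9 : c2 + c1 + x + 1 + (x + 1 + r + 1) ≠ 0 := by
    have := g12.add_intCast_ne_zero (x + 1 + (x + 1 + r + 1))
    push_cast at this
    convert this using 1
    ring
  rw [hch, ← hp, coefB, coefD]
  generalize poch (c2 + c1 + x + 1) (x + 1 + r + 1) = p at n2 ⊢
  generalize poch (c1 + 1) x = q at n1 ⊢
  generalize ((x + 1 + r).choose x : ℝ) = C
  generalize poch (c2 + 1) x = a
  generalize poch (x + 1 + r + 2 + c3 + c2 + c1) x = b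
  generalize poch (c3 + 1) r = e
  obtain ⟨d, hd⟩ : ∃ d, d = 2 * x + c1 + c2 + 1 := ⟨_, rfl⟩
  obtain ⟨f, hf⟩ : ∃ f, f = c2 + c1 + x + 1 := ⟨_, rfl⟩
  rw [show 2 * (x : ℝ) + c1 + c2 + 2 = d + 1 by rw [hd]; ring] at n5 ⊢
  rw [show 2 * (x : ℝ) + c1 + c2 + 3 = d + 2 by rw [hd]; ring] at n6
  rw [show 2 * ((x : ℝ) + 1) + c1 + c2 + 1 = d + 2 by rw [hd]; ring,
    show 2 * ((x : ℝ) + 1) + c1 + c2 = d + 1 by rw [hd]; ring]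
  rw [← hd] at n4 ⊢
  rw [← hf] at n8 n9 ⊢
  rw [show 2 * (x : ℝ) + c2 + c1 + 1 = d by rw [hd]; ring,
    show 2 * ((x : ℝ) + 1) + c2 + c1 + 1 = d + 2 by rw [hd]; ring,
    show (x : ℝ) + c1 + c2 + 1 = f by rw [hf]; ring]
  have n10 : (x : ℝ) + 1 + r + 1 ≠ 0 := by positivity
  field_simp
  subst hd hf
  ring

lemma sum_Om_mul_coef_eq_zero {c1 c2 c3 : ℝ} (hg : Generic3 c1 c2 c3) (M : ℕ) (u v : ℝ → ℝ)
    (huv : ∀ x, v (x + 1) = -u x) :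
    ∑ x ∈ Finset.range (M + 1),
      Om x c3 c2 c1 M * (coefB x c1 c2 c3 M * u x + coefD x c1 c2 c3 M * v x) = 0 := by
  have partialSum : ∀ K ≤ M, ∑ x ∈ Finset.range (K + 1),
      Om x c3 c2 c1 M * (coefB x c1 c2 c3 M * u x + coefD x c1 c2 c3 M * v x) =
        Om K c3 c2 c1 M * coefB K c1 c2 c3 M * u K := by
    intro K
    induction K with
    | zero => intro _; simp [coefD, mul_assoc]
    | succ K ih =>
      intro hK
      rw [Finset.sum_range_succ, ih (by omega), Om_mul_coefB hg hK]
      push_cast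
      rw [huv]
      ring
  rw [partialSum M le_rfl]
  simp [coefB]

lemma two_mul_add_ne_zero {c1 c2 : ℝ} (h : Generic (c1 + c2)) (x : ℕ) :
    2 * (x : ℝ) + c1 + c2 ≠ 0 ∧ 2 * (x : ℝ) + c1 + c2 + 1 ≠ 0 ∧
      2 * (x : ℝ) + c1 + c2 + 2 ≠ 0 := by
  have key (m : ℕ) : 2 * (x : ℝ) + c1 + c2 + m ≠ 0 := by
    have := h.add_intCast_ne_zero (2 * x + m)
    push_cast at this
    convert this using 1
    ring
  exact ⟨by simpa using key 0, by simpa using key 1, by simpa using key 2⟩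

lemma sum_Om_mul_racahSum_of_ne {c1 c2 c3 : ℝ} (hg : Generic3 c1 c2 c3) {n m M : ℕ}
    (hn : n ≤ M) (hm : m ≤ M) (hnm : n ≠ m) :
    ∑ x ∈ Finset.range (M + 1), Om x c3 c2 c1 M *
      (racahSum n x c1 c2 c3 M (M + 1) * racahSum m x c1 c2 c3 M (M + 1)) = 0 := by
  set f : ℝ → ℝ := fun x => racahSum n x c1 c2 c3 M (M + 1) with hf
  set g : ℝ → ℝ := fun x => racahSum m x c1 c2 c3 M (M + 1) with hgdef
  have h := sum_Om_mul_coef_eq_zero hg M (fun x : ℝ => f (x + 1) * g x - f x * g (x + 1))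
    (fun x : ℝ => f (x - 1) * g x - f x * g (x - 1)) (fun x => by simp only [add_sub_cancel_right]; ring)
  have hne : ((n : ℝ) - m) * (n + m + c2 + c3 + 1) ≠ 0 := by
    apply mul_ne_zero
    · rw [sub_ne_zero]; exact_mod_cast hnm
    · have := hg.2.2.2.2.2.1.add_intCast_ne_zero (n + m + 1)
      push_cast at this
      convert this using 1
      ring
  apply mul_left_cancel₀ hne
  rw [mul_zero, Finset.mul_sum]
  refine (Finset.sum_congr rfl ?_).trans h
  intro x _
  obtain ⟨h0, h1, h2⟩ := two_mul_add_ne_zero hg.2.2.2.1 x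
  have e1 := racahDiff_racahSum hg n M hn h0 h1 h2
  have e2 := racahDiff_racahSum hg m M hm h0 h1 h2
  simp only [racahDiff] at e1 e2
  simp only [hf, hgdef]
  linear_combination Om x c3 c2 c1 M * (racahSum n x c1 c2 c3 M (M + 1) * e2 -
    racahSum m x c1 c2 c3 M (M + 1) * e1)

lemma sum_Om_mul_quadPoch_one {c1 c2 c3 : ℝ} (hg : Generic3 c1 c2 c3) (M : ℕ) :
    (c2 + c3 + 2) * ∑ x ∈ Finset.range (M + 1), Om x c3 c2 c1 M * quadPoch (c1 + c2) x 1 =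
      -(M * (c2 + 1) * (M + 2 + c1 + c2 + c3)) * ∑ x ∈ Finset.range (M + 1), Om x c3 c2 c1 M := by
  set f : ℝ → ℝ := fun x => quadPoch (c1 + c2) x 1 with hf
  have h := sum_Om_mul_coef_eq_zero hg M (fun x : ℝ => f (x + 1) - f x)
    (fun x : ℝ => f (x - 1) - f x) (fun x => by simp only [add_sub_cancel_right]; ring)
  rw [← sub_eq_zero, ← h, Finset.mul_sum, Finset.mul_sum, ← Finset.sum_sub_distrib]
  apply Finset.sum_congr rfl
  intro x _
  obtain ⟨h0, h1, h2⟩ := two_mul_add_ne_zero hg.2.2.2.1 x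
  have e := racahDiff_quadPoch_succ c3 M 0 h0 h1 h2
  simp only [racahDiff, quadPoch_zero, Nat.cast_zero, zero_add] at e
  simp only [hf]
  linear_combination (-Om x c3 c2 c1 M) * e

lemma Om_succ_mul {c1 c2 c3 : ℝ} (hg : Generic3 c1 c2 c3) {x M : ℕ} (hx : x ≤ M) :
    Om x c3 c2 c1 (M + 1 : ℕ) * ((M + 1) * (c1 + c2 + M + 2) + quadPoch (c1 + c2) x 1) *
        (M + 2 + c1 + c2 + c3) =
      (M + 1) * (Om x c3 c2 c1 M *
        ((c3 + 1 + M) * (M + 2 + c1 + c2 + c3) + quadPoch (c1 + c2) x 1)) := by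
  obtain ⟨g1, -, -, g12, -, -, -⟩ := hg
  rw [Om_natCast hx, Om_natCast (show x ≤ M + 1 by omega)]
  obtain ⟨r, rfl⟩ : ∃ r, M = x + r := ⟨M - x, by omega⟩
  rw [show x + r + 1 - x = r + 1 by omega, show x + r - x = r by omega]
  have hch : ((x + r + 1).choose x : ℝ) * (r + 1) = ((x + r).choose x : ℝ) * (x + r + 1) := by
    have := Nat.choose_mul_succ_eq (x + r) x
    rw [show x + r + 1 - x = r + 1 by omega] at this
    exact_mod_cast this.symm
  have hb : (((x + r : ℕ) : ℝ) + 2 + c1 + c2 + c3) *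
      poch ((x + r + 1 : ℕ) + 2 + c3 + c2 + c1) x =
      poch ((x + r : ℕ) + 2 + c3 + c2 + c1) x * ((x + r : ℕ) + 2 + c3 + c2 + c1 + x) := by
    rw [← poch_succ, poch_succ_left]
    push_cast
    ring_nf
  have n1 : poch (c1 + 1) x ≠ 0 := poch_ne_zero g1 1 (by push_cast; ring) _
  have n2 : poch (c2 + c1 + x + 1) (x + r + 1) ≠ 0 :=
    poch_ne_zero g12 (x + 1) (by push_cast; ring) _
  have n3 : c2 + c1 + x + 1 + (x + r + 1) ≠ 0 := by
    have := g12.add_intCast_ne_zero (x + 1 + (x + r + 1))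
    push_cast at this
    convert this using 1
    ring
  have hq : quadPoch (c1 + c2) x 1 = -x * (x + c1 + c2 + 1) := by
    simp only [quadPoch, poch, Finset.prod_range_one]
    push_cast
    ring
  rw [hq, poch_succ _ (x + r + 1), poch_succ (c3 + 1) r]
  push_cast at hb ⊢
  generalize poch (c2 + c1 + x + 1) (x + r + 1) = p at n2 ⊢
  generalize poch (c1 + 1) x = q at n1 ⊢
  generalize ((x + r).choose x : ℝ) = C at hch ⊢
  generalize ((x + r + 1).choose x : ℝ) = C' at hch ⊢
  generalize poch (x + r + 2 + c3 + c2 + c1) x = b at hb ⊢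
  generalize poch (x + r + 1 + 2 + c3 + c2 + c1) x = b' at hb ⊢
  rw [show ((x : ℝ) + r + 1) * (c1 + c2 + (x + r) + 2) + -x * (x + c1 + c2 + 1) =
    (r + 1) * (c2 + c1 + x + 1 + (x + r + 1)) by ring,
    show (c3 + 1 + ((x : ℝ) + r)) * (x + r + 2 + c1 + c2 + c3) + -x * (x + c1 + c2 + 1) =
    (c3 + 1 + r) * (x + r + 2 + c3 + c2 + c1 + x) by ring]
  have hcb : C' * (r + 1) * ((x + r + 2 + c1 + c2 + c3) * b') =
      C * (x + r + 1) * (b * (x + r + 2 + c3 + c2 + c1 + x)) := by rw [hch, hb]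
  generalize c2 + c1 + x + 1 + ((x : ℝ) + r + 1) = t at n3 ⊢
  generalize c3 + 1 + (r : ℝ) = s
  generalize (x : ℝ) + r + 2 + c3 + c2 + c1 + x = v at hcb ⊢
  generalize (x : ℝ) + r + 2 + c1 + c2 + c3 = u at hcb ⊢
  field_simp
  linear_combination (2 * x + c2 + c1 + 1) * s * poch (c2 + 1) x * poch (c3 + 1) r * hcb

lemma sum_Om {c1 c2 c3 : ℝ} (hg : Generic3 c1 c2 c3) (M : ℕ) :
    poch (c1 + 1) M * ∑ x ∈ Finset.range (M + 1), Om x c3 c2 c1 M = poch (c2 + c3 + 2) M := by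
  induction M with
  | zero =>
    have h : c2 + c1 + 1 ≠ 0 := by
      have := hg.2.2.2.1.add_intCast_ne_zero 1
      push_cast at this
      convert this using 1
      ring
    simp [Om, poch_succ, poch_zero, h]
  | succ M ih =>
    have m1 := sum_Om_mul_quadPoch_one hg M
    have m2 := sum_Om_mul_quadPoch_one hg (M + 1)
    have hs : ∑ x ∈ Finset.range (M + 1 + 1), Om x c3 c2 c1 (M + 1 : ℕ) *
          ((M + 1) * (c1 + c2 + M + 2) + quadPoch (c1 + c2) x 1) * (M + 2 + c1 + c2 + c3) =
        (M + 1) * ∑ x ∈ Finset.range (M + 1), Om x c3 c2 c1 M *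
          ((c3 + 1 + M) * (M + 2 + c1 + c2 + c3) + quadPoch (c1 + c2) x 1) := by
      rw [Finset.sum_range_succ, Finset.mul_sum,
        Finset.sum_congr rfl fun x hx => Om_succ_mul hg (by rw [Finset.mem_range] at hx; omega)]
      have : ((M : ℝ) + 1) * (c1 + c2 + M + 2) + quadPoch (c1 + c2) (M + 1 : ℕ) 1 = 0 := by
        simp only [quadPoch, poch, Finset.prod_range_one]
        push_cast
        ring
      rw [this]
      ring
    simp only [mul_add, Finset.sum_add_distrib, ← Finset.sum_mul] at hs
    push_cast at m2 hs
    set Z := ∑ x ∈ Finset.range (M + 1), Om x c3 c2 c1 M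
    set Z' := ∑ x ∈ Finset.range (M + 1 + 1), Om x c3 c2 c1 (M + 1 : ℕ) with hZ'
    push_cast at hZ'
    rw [← hZ'] at m2 hs
    have hne : (M + 2 + c1 + c2 + c3) * ((M + 1) * (c3 + 1)) ≠ 0 := by
      refine mul_ne_zero ?_ (mul_ne_zero (by positivity) ?_)
      · have := hg.2.2.2.2.2.2.add_intCast_ne_zero (M + 2)
        push_cast at this
        convert this using 1
        ring
      · exact_mod_cast hg.2.2.1.add_intCast_ne_zero 1
    have step : (c1 + 1 + M) * Z' = (c2 + c3 + 2 + M) * Z := by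
      apply mul_left_cancel₀ hne
      linear_combination (c2 + c3 + 2) * hs - (M + 2 + c1 + c2 + c3) * m2 + (M + 1) * m1
    rw [poch_succ, poch_succ, ← ih]
    linear_combination poch (c1 + 1) M * step

/-- Orthogonality of the Racah polynomials on `{0, …, M}`. -/
lemma Om_mul_sum_racahSum {c1 c2 c3 : ℝ} (hg : Generic3 c1 c2 c3) {n m M : ℕ}
    (hn : n ≤ M) (hm : m ≤ M) :
    Om n c1 c2 c3 M * ∑ x ∈ Finset.range (M + 1), Om x c3 c2 c1 M *
      (racahSum n x c1 c2 c3 M (M + 1) * racahSum m x c1 c2 c3 M (M + 1)) =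
      if n = m then 1 else 0 := by
  split_ifs with hnm
  swap
  · rw [sum_Om_mul_racahSum_of_ne hg hn hm hnm, mul_zero]
  subst hnm
  set S : ℕ → ℕ → ℝ := fun n x => racahSum n x c1 c2 c3 M (M + 1) with hS
  have total : Om (0 : ℕ) c1 c2 c3 M * ∑ x ∈ Finset.range (M + 1), Om x c3 c2 c1 M = 1 := by
    have g23 := hg.2.2.2.2.2.1
    have n1 : poch (c2 + c3 + 2) M ≠ 0 := poch_ne_zero g23 2 (by push_cast; ring) _
    have n2 : c2 + c3 + 1 ≠ 0 := by exact_mod_cast g23.add_intCast_ne_zero 1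
    rw [Om_natCast (Nat.zero_le M)]
    simp only [Nat.choose_zero_right, Nat.cast_zero, Nat.cast_one, poch_zero, poch_succ_left,
      Nat.sub_zero, mul_zero, zero_add, add_zero, one_mul, mul_one]
    rw [show c2 + c3 + 1 + 1 = c2 + c3 + 2 by ring, mul_div_mul_left _ _ n2, div_mul_eq_mul_div,
      sum_Om hg, div_self n1]
  have diag : ∀ k ≤ M, Om k c1 c2 c3 M * ∑ x ∈ Finset.range (M + 1), Om x c3 c2 c1 M *
      (S k x * S k x) = Om (0 : ℕ) c3 c2 c1 M * ∑ l ∈ Finset.range (M + 1), Om l c1 c2 c3 M := by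
    intro k hk
    have inner_l : ∑ x ∈ Finset.range (M + 1), ∑ l ∈ Finset.range (M + 1),
        Om x c3 c2 c1 M * Om l c1 c2 c3 M * S k x * S l x =
        Om (0 : ℕ) c3 c2 c1 M * ∑ l ∈ Finset.range (M + 1), Om l c1 c2 c3 M := by
      rw [Finset.sum_eq_single_of_mem 0 (by simp), Finset.mul_sum]
      · simp [hS, racahSum_zero_right]
      · intro x hx hx0
        have := sum_Om_mul_racahSum_of_ne hg.reverse (show x ≤ M by simp at hx; omega)
          (Nat.zero_le M) hx0
        calc _ = Om x c3 c2 c1 M * S k x * ∑ l ∈ Finset.range (M + 1), Om l c1 c2 c3 M *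
              (racahSum x l c3 c2 c1 M (M + 1) * racahSum (0 : ℕ) l c3 c2 c1 M (M + 1)) := by
              rw [Finset.mul_sum]
              refine Finset.sum_congr rfl fun l _ => ?_
              rw [Nat.cast_zero, racahSum_zero_left, racahSum_swap x l]
              ring
          _ = 0 := by rw [this, mul_zero]
    have inner_x : ∑ l ∈ Finset.range (M + 1), ∑ x ∈ Finset.range (M + 1),
        Om x c3 c2 c1 M * Om l c1 c2 c3 M * S k x * S l x =
        Om k c1 c2 c3 M * ∑ x ∈ Finset.range (M + 1), Om x c3 c2 c1 M * (S k x * S k x) := by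
      rw [Finset.sum_eq_single_of_mem k (by simp; omega), Finset.mul_sum]
      · exact Finset.sum_congr rfl fun _ _ => by ring
      · intro l hl hlk
        have := sum_Om_mul_racahSum_of_ne hg hk (show l ≤ M by simp at hl; omega) hlk.symm
        calc _ = Om l c1 c2 c3 M * ∑ x ∈ Finset.range (M + 1), Om x c3 c2 c1 M *
              (racahSum k x c1 c2 c3 M (M + 1) * racahSum l x c1 c2 c3 M (M + 1)) := by
              rw [Finset.mul_sum]; exact Finset.sum_congr rfl fun _ _ => by ring
          _ = 0 := by rw [this, mul_zero]
    rw [← inner_x, ← inner_l, Finset.sum_comm]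
  rw [diag n hn, ← diag 0 (Nat.zero_le M), ← total]
  simp [hS, racahSum_zero_left]

lemma sum_Om_mul_racah_mul_racah {c1 c2 c3 : ℝ} (hg : Generic3 c1 c2 c3) (a b M : ℕ) :
    ∑ x ∈ Finset.range (M + 1), Om x c3 c2 c1 M *
      (racah a (x : ℝ) c1 c2 c3 M * racah b (x : ℝ) c1 c2 c3 M) =
      if a = b ∧ a ≤ M then Om a c1 c2 c3 M else 0 := by
  have vanish : ∀ n : ℕ, M < n → ∀ x, racah n x c1 c2 c3 M = 0 := fun n hn x =>
    if_neg fun h => by omega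
  rcases lt_or_ge M a with ha | ha
  · rw [if_neg (by omega)]
    exact Finset.sum_eq_zero fun x _ => by rw [vanish a ha]; ring
  rcases lt_or_ge M b with hb | hb
  · rw [if_neg (by omega)]
    exact Finset.sum_eq_zero fun x _ => by rw [vanish b hb]; ring
  have h := Om_mul_sum_racahSum hg ha hb
  calc _ = Om b c1 c2 c3 M * (Om a c1 c2 c3 M * ∑ x ∈ Finset.range (M + 1), Om x c3 c2 c1 M *
      (racahSum a x c1 c2 c3 M (M + 1) * racahSum b x c1 c2 c3 M (M + 1))) := by
        rw [Finset.mul_sum, Finset.mul_sum]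
        refine Finset.sum_congr rfl fun x _ => ?_
        rw [racah_natCast ha, racah_natCast hb]
        ring
    _ = _ := by
        rw [h]
        by_cases hab : a = b
        · subst hab; simp [ha]
        · simp [hab]

lemma Lam_mul_Om_exchange {c0 c1 c2 c3 c4 : ℝ} {a y N : ℕ} (h : a + y ≤ N)
    (hsum : c0 = -2 * N - 3 - c1 - c2 - c3 - c4) (g12 : Generic (c1 + c2))
    (g03 : Generic (c0 + c3)) :
    Lam y c3 c0 N * Om a c4 c2 c1 (N - y : ℕ) = Lam a c1 c2 N * Om y c4 c0 c3 (N - a : ℕ) := by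
  rw [Om_natCast (by omega), Om_natCast (by omega), Lam, Lam]
  simp only [Int.toNat_natCast, Int.cast_natCast]
  obtain ⟨r, rfl⟩ : ∃ r, N = a + y + r := ⟨N - (a + y), by omega⟩
  rw [show a + y + r - y = a + r by omega, show a + y + r - a = y + r by omega,
    show a + r - a = r by omega, show y + r - y = r by omega]
  have hch : ((a + y + r).choose y : ℝ) * (a + r).choose a =
      (a + y + r).choose a * (y + r).choose y := by
    have h1 := Nat.choose_mul (n := a + y + r) (k := a + y) (s := y) (by omega)
    have h2 := Nat.choose_mul (n := a + y + r) (k := a + y) (s := a) (by omega)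
    rw [show a + y + r - y = a + r by omega, Nat.add_sub_cancel] at h1
    rw [show a + y + r - a = y + r by omega, Nat.add_sub_cancel_left,
      Nat.choose_symm_add (a := a) (b := y)] at h2
    exact_mod_cast h1.symm.trans h2
  have r1 : poch ((a + r : ℕ) + 2 + c4 + c2 + c1) a =
      (-1) ^ a * poch (y + c3 + c0 + 1 + (y + r + 1 : ℕ)) a := by
    rw [show ((a + r : ℕ) : ℝ) + 2 + c4 + c2 + c1 = -(c0 + c3 + a + 2 * y + r + 1) by
      rw [hsum]; push_cast; ring, poch_reflect]
    congr 2
    push_cast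
    ring
  have r2 : poch ((y + r : ℕ) + 2 + c4 + c0 + c3) y =
      (-1) ^ y * poch (a + c1 + c2 + 1 + (a + r + 1 : ℕ)) y := by
    rw [show ((y + r : ℕ) : ℝ) + 2 + c4 + c0 + c3 = -(c1 + c2 + y + 2 * a + r + 1) by
      rw [hsum]; push_cast; ring, poch_reflect]
    congr 2
    push_cast
    ring
  have n1 : poch (y + c3 + c0 + 1 + (y + r + 1 : ℕ)) a ≠ 0 :=
    poch_ne_zero g03 (y + 1 + (y + r + 1 : ℕ)) (by push_cast; ring) _
  have n2 : poch (a + c1 + c2 + 1 + (a + r + 1 : ℕ)) y ≠ 0 :=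
    poch_ne_zero g12 (a + 1 + (a + r + 1 : ℕ)) (by push_cast; ring) _
  rw [r1, r2, show a + y + r + 1 = (y + r + 1) + a by ring, poch_add (y + c3 + c0 + 1),
    show y + r + 1 + a = (a + r + 1) + y by ring, poch_add (a + c1 + c2 + 1),
    show c2 + c1 + a + 1 = a + c1 + c2 + 1 by ring, show c0 + c3 + y + 1 = y + c3 + c0 + 1 by ring,
    show 2 * (a : ℝ) + c2 + c1 + 1 = 2 * a + c1 + c2 + 1 by ring,
    show 2 * (y : ℝ) + c0 + c3 + 1 = 2 * y + c3 + c0 + 1 by ring]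
  generalize poch (y + c3 + c0 + 1 + (y + r + 1 : ℕ)) a = p1 at n1 ⊢
  generalize poch (a + c1 + c2 + 1 + (a + r + 1 : ℕ)) y = p2 at n2 ⊢
  calc _ = (((a + y + r).choose y : ℝ) * (a + r).choose a) * ((-1) ^ a * (-1) ^ y *
        (2 * y + c3 + c0 + 1) * (2 * a + c1 + c2 + 1) * poch (c0 + 1) y * poch (c2 + 1) a *
        poch (c4 + 1) r * (p1 / p1) / (poch (c3 + 1) y * poch (c1 + 1) a *
        poch (y + c3 + c0 + 1) (y + r + 1) * poch (a + c1 + c2 + 1) (a + r + 1))) := by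
        ring
    _ = (((a + y + r).choose a : ℝ) * (y + r).choose y) * ((-1) ^ a * (-1) ^ y *
        (2 * y + c3 + c0 + 1) * (2 * a + c1 + c2 + 1) * poch (c0 + 1) y * poch (c2 + 1) a *
        poch (c4 + 1) r * (p2 / p2) / (poch (c3 + 1) y * poch (c1 + 1) a *
        poch (y + c3 + c0 + 1) (y + r + 1) * poch (a + c1 + c2 + 1) (a + r + 1))) := by
        rw [hch, div_self n1, div_self n2]
    _ = _ := by ring

lemma grif_natCast (c1 c2 c3 c4 : ℝ) {N i j x y : ℕ} (hij : i + j ≤ N) (hxy : x + y ≤ N) :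
    grif c1 c2 c3 c4 N i j x y = ∑ a ∈ Finset.range (N + 1),
      (-1 : ℝ) ^ a * racah i (a : ℝ) c1 c2 c3 (N - j : ℕ) *
        racah j (y : ℝ) c3 (-2 * N - 3 - c1 - c2 - c3 - c4) c4 (N - a : ℕ) *
        racah a (x : ℝ) c4 c2 c1 (N - y : ℕ) := by
  rw [grif, if_pos (by omega), ← Nat.cast_sub (by omega : j ≤ N),
    ← Nat.cast_sub (by omega : y ≤ N), Int.toNat_natCast]
  have hsub : Finset.range (N - j + 1) ⊆ Finset.range (N + 1) := Finset.range_mono (by omega)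
  rw [← Finset.sum_subset hsub]
  · refine Finset.sum_congr rfl fun a ha => ?_
    rw [Finset.mem_range] at ha
    rw [Nat.cast_sub (by omega : a ≤ N), Int.cast_natCast, Int.cast_natCast]
  · intro a ha ha'
    rw [Finset.mem_range] at ha ha'
    have : racah j (y : ℝ) c3 (-2 * N - 3 - c1 - c2 - c3 - c4) c4 (N - a : ℕ) = 0 :=
      if_neg fun h => by omega
    rw [this]
    ring

lemma Generic4.generic3_conj {c0 c1 c2 c3 c4 : ℝ} {N : ℕ} (h : Generic4 c1 c2 c3 c4)
    (hsum : c0 = -2 * N - 3 - c1 - c2 - c3 - c4) : Generic3 c3 c0 c4 := by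
  obtain ⟨-, -, h3, h4, h12, -, -, -, -, h34, h123, h124, -, -, h1234⟩ := h
  have key {r s : ℝ} (hr : Generic r) (hs : s = -2 * N - 3 - r) : Generic s :=
    hr.of_eq_neg_add (-2 * N - 3) (by rw [hs]; push_cast; ring)
  refine ⟨h3, key h1234 ?_, h4, key h124 ?_, h34, key h123 ?_, key h12 ?_⟩ <;> rw [hsum] <;> ring

/-- orthogonality relation for the Griffiths polynomials of Racah type. -/
theorem griffiths_orthogonality
    (Nn : ℕ) (c1 c2 c3 c4 : ℝ) (hgen : Generic4 c1 c2 c3 c4)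
    (c0 : ℝ) (hc0 : c0 = -2*(Nn:ℝ)-3-c1-c2-c3-c4)
    (i j k l : ℤ) (hi : 0 ≤ i) (hj : 0 ≤ j) (hij : i + j ≤ (Nn:ℤ))
    (hk : 0 ≤ k) (hl : 0 ≤ l) (hkl : k + l ≤ (Nn:ℤ)) :
    ∑ x ∈ Finset.range (Nn+1), ∑ y ∈ Finset.range (Nn+1-x),
      Lam (y:ℤ) c3 c0 (Nn:ℤ) * Om (x:ℤ) c1 c2 c4 ((Nn:ℤ)-(y:ℤ)) *
        grif c1 c2 c3 c4 Nn i j (x:ℤ) (y:ℤ) * grif c1 c2 c3 c4 Nn k l (x:ℤ) (y:ℤ) =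
      (if i = k ∧ j = l then Lam j c4 c0 (Nn:ℤ) * Om i c1 c2 c3 ((Nn:ℤ)-j) else 0) := by
  lift i to ℕ using hi
  lift j to ℕ using hj
  lift k to ℕ using hk
  lift l to ℕ using hl
  have g304 : Generic3 c3 c0 c4 := hgen.generic3_conj hc0
  have g03 : Generic (c0 + c3) := add_comm c3 c0 ▸ g304.2.2.2.1
  have g04 : Generic (c0 + c4) := g304.2.2.2.2.2.1
  obtain ⟨h1, h2, h3, h4, h12, h13, h14, h23, h24, h34, h123, h124, h134, h234, h1234⟩ := hgen
  have g123 : Generic3 c1 c2 c3 := ⟨h1, h2, h3, h12, h13, h23, h123⟩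
  have g421 : Generic3 c4 c2 c1 := Generic3.reverse ⟨h1, h2, h4, h12, h14, h24, h124⟩
  set P : ℕ → ℕ → ℕ → ℝ := fun i j a => racah i (a : ℝ) c1 c2 c3 (Nn - j : ℕ) with hP
  set Q : ℕ → ℕ → ℕ → ℝ := fun j a y => racah j (y : ℝ) c3 c0 c4 (Nn - a : ℕ) with hQ
  set R : ℕ → ℕ → ℕ → ℝ := fun a y x => racah a (x : ℝ) c4 c2 c1 (Nn - y : ℕ) with hR
  have sum_x : ∀ y a b, ∑ x ∈ Finset.range (Nn - y + 1),
      Om x c1 c2 c4 (Nn - y : ℕ) * (R a y x * R b y x) =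
        if a = b ∧ a ≤ Nn - y then Om a c4 c2 c1 (Nn - y : ℕ) else 0 :=
    fun y a b => sum_Om_mul_racah_mul_racah g421 a b (Nn - y)
  have sum_y : ∀ a, ∑ y ∈ Finset.range (Nn - a + 1),
      Om y c4 c0 c3 (Nn - a : ℕ) * (Q j a y * Q l a y) =
        if j = l ∧ j ≤ Nn - a then Om j c3 c0 c4 (Nn - a : ℕ) else 0 :=
    fun a => sum_Om_mul_racah_mul_racah g304 j l (Nn - a)
  have expand : ∀ y ∈ Finset.range (Nn + 1), ∑ x ∈ Finset.range (Nn - y + 1),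
      Lam (y:ℤ) c3 c0 (Nn:ℤ) * Om (x:ℤ) c1 c2 c4 ((Nn:ℤ)-(y:ℤ)) *
        grif c1 c2 c3 c4 Nn i j (x:ℤ) (y:ℤ) * grif c1 c2 c3 c4 Nn k l (x:ℤ) (y:ℤ) =
      ∑ a ∈ Finset.range (Nn - y + 1), Lam a c1 c2 Nn * Om y c4 c0 c3 (Nn - a : ℕ) *
        (P i j a * P k l a * (Q j a y * Q l a y)) := by
    intro y hy
    rw [Finset.mem_range] at hy
    calc _ = ∑ x ∈ Finset.range (Nn - y + 1), ∑ a ∈ Finset.range (Nn + 1),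
          ∑ b ∈ Finset.range (Nn + 1), (Lam y c3 c0 Nn * ((-1) ^ a * (-1) ^ b) *
            (P i j a * P k l b * (Q j a y * Q l b y))) *
            (Om x c1 c2 c4 (Nn - y : ℕ) * (R a y x * R b y x)) := by
          refine Finset.sum_congr rfl fun x hx => ?_
          rw [Finset.mem_range] at hx
          rw [grif_natCast _ _ _ _ (by omega) (by omega), grif_natCast _ _ _ _ (by omega) (by omega),
            ← hc0, mul_assoc, Finset.sum_mul_sum, Finset.mul_sum, ← Nat.cast_sub (by omega)]
          refine Finset.sum_congr rfl fun a _ => ?_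
          rw [Finset.mul_sum]
          refine Finset.sum_congr rfl fun b _ => ?_
          simp only [hP, hQ, hR]
          ring
      _ = ∑ a ∈ Finset.range (Nn + 1), ∑ b ∈ Finset.range (Nn + 1),
          (Lam y c3 c0 Nn * ((-1) ^ a * (-1) ^ b) *
            (P i j a * P k l b * (Q j a y * Q l b y))) *
            (if a = b ∧ a ≤ Nn - y then Om a c4 c2 c1 (Nn - y : ℕ) else 0) := by
          rw [Finset.sum_comm]
          refine Finset.sum_congr rfl fun a _ => ?_
          rw [Finset.sum_comm]
          refine Finset.sum_congr rfl fun b _ => ?_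
          rw [← Finset.mul_sum, sum_x]
      _ = _ := by
          rw [← Finset.sum_subset (Finset.range_mono (by omega : Nn - y + 1 ≤ Nn + 1))]
          · refine Finset.sum_congr rfl fun a ha => ?_
            rw [Finset.mem_range] at ha
            rw [Finset.sum_eq_single_of_mem a (by simp; omega) fun b _ hb => by
              rw [if_neg (fun h => hb h.1.symm), mul_zero], if_pos ⟨rfl, by omega⟩, ← mul_pow,
              ← Lam_mul_Om_exchange (by omega) hc0 h12 g03]
            norm_num
            ring
          · intro a _ ha
            rw [Finset.mem_range] at ha
            exact Finset.sum_eq_zero fun b _ => by rw [if_neg (by omega), mul_zero]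
  calc _ = ∑ y ∈ Finset.range (Nn + 1), ∑ x ∈ Finset.range (Nn - y + 1),
      Lam (y:ℤ) c3 c0 (Nn:ℤ) * Om (x:ℤ) c1 c2 c4 ((Nn:ℤ)-(y:ℤ)) *
        grif c1 c2 c3 c4 Nn i j (x:ℤ) (y:ℤ) * grif c1 c2 c3 c4 Nn k l (x:ℤ) (y:ℤ) :=
        Finset.sum_comm' fun x y => by simp only [Finset.mem_range]; omega
    _ = ∑ a ∈ Finset.range (Nn + 1), ∑ y ∈ Finset.range (Nn - a + 1),
        Lam a c1 c2 Nn * Om y c4 c0 c3 (Nn - a : ℕ) *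
          (P i j a * P k l a * (Q j a y * Q l a y)) := by
        rw [Finset.sum_congr rfl expand]
        exact Finset.sum_comm' fun x y => by simp only [Finset.mem_range]; omega
    _ = ∑ a ∈ Finset.range (Nn + 1), Lam a c1 c2 Nn * (P i j a * P k l a) *
        (if j = l ∧ j ≤ Nn - a then Om j c3 c0 c4 (Nn - a : ℕ) else 0) := by
        refine Finset.sum_congr rfl fun a _ => ?_
        rw [← sum_y, Finset.mul_sum]
        exact Finset.sum_congr rfl fun y _ => by ring
    _ = _ := by
        by_cases hjl : j = l
        swap
        · simp [hjl]
        subst hjl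
        rw [← Finset.sum_subset (Finset.range_mono (by omega : Nn - j + 1 ≤ Nn + 1))]
        · have sum_a := sum_Om_mul_racah_mul_racah g123 i k (Nn - j)
          calc _ = ∑ a ∈ Finset.range (Nn - j + 1), Lam j c4 c0 Nn *
                (Om a c3 c2 c1 (Nn - j : ℕ) * (P i j a * P k j a)) := by
                refine Finset.sum_congr rfl fun a ha => ?_
                rw [Finset.mem_range] at ha
                rw [if_pos ⟨rfl, by omega⟩]
                have e := Lam_mul_Om_exchange (a := a) (y := j) (c4 := c3) (c3 := c4) (N := Nn)
                  (by omega) (by rw [hc0]; ring) h12 g04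
                linear_combination (-(P i j a * P k j a)) * e
            _ = _ := by
                rw [← Finset.mul_sum, sum_a, ← Nat.cast_sub (by omega : j ≤ Nn)]
                have : i ≤ Nn - j := by omega
                simp [this]
        · intro a haN ha
          rw [Finset.mem_range] at haN ha
          rw [if_neg (by omega), mul_zero]
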